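/- arXiv:1701.07184 — 8 statements merged into one kernel-verified Lean document; each statement's English description precedes it below -/
import Mathlib

section
/- Let F be a finite field, and let m ≥ 2, n, k, t be integers with k, n positive, t ≥ 0, (m-1)·t ≤ k - 1 and k + t ≤ n. Let C be an F-linear subspace of the space of vectors indexed by pairs (b, i) with b ∈ {1,...,m} and i ∈ {1,...,n} (so C is a linear code of length m·n whose coordinates are partitioned into m sub-blocks of length n each), and suppose dim_F C = m·k. Assume that for every codeword c ∈ C and every sub-block b ∈ {1,...,m}, if the restriction of c to sub-block b is not the zero vector then this restriction has Hamming weight at least n - k - t + 1. Then there exists a nonzero codeword c ∈ C whose Hamming weight is at most n - k + (m-1)·t + 1; that is, the minimum distance d of C satisfies d ≤ n - k + (m-1)·t + 1. -/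
theorem aux_card_lt (n a : ℕ) : (Finset.univ.filter (fun i : Fin n => i.val < a)).card ≤ a := by
  have h := Finset.card_le_card_of_injOn (s := Finset.univ.filter (fun i : Fin n => i.val < a))
    (t := Finset.range a) (fun i => i.val) (by intro i hi; simpa using hi)
    (fun x _ y _ h => Fin.ext h)
  simpa using h

theorem aux_weight {F : Type*} [Field F] [DecidableEq F] (n a : ℕ) (v : Fin n → F)
    (hv : ∀ i : Fin n, i.val < a → v i = 0) : hammingNorm v ≤ n - a := by
  unfold hammingNorm
  have h := Finset.card_le_card_of_injOn (s := Finset.univ.filter (fun i : Fin n => v i ≠ 0))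
    (t := Finset.Ico a n) (fun i => i.val) (by
      intro i hi
      have hi' : v i ≠ 0 := by simpa using hi
      have : ¬ i.val < a := fun h => hi' (hv i h)
      simp only [Finset.coe_Ico, Set.mem_Ico]
      exact ⟨by omega, i.2⟩)
    (fun x _ y _ h => Fin.ext h)
  simpa using h

/-- Theorem 1 (bound on the minimum distance of multi-block interleaved codes):
if a linear code of length `m * n` and dimension `m * k`, whose coordinates are
partitioned into `m` sub-blocks of length `n`, has sub-block minimum distance at least
`n - k - t + 1`, and `(m-1)·t ≤ k - 1`, then its minimum distance is at most
`n - k + (m-1)·t + 1`, i.e. there is a nonzero codeword of at most that Hamming weight. -/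
theorem multiblock_distance_bound
    (F : Type*) [Field F] [Fintype F] [DecidableEq F]
    (m n k t : ℕ) (hm : 2 ≤ m) (hn : 0 < n) (hk : 0 < k)
    (hmt : (m - 1) * t ≤ k - 1) (hkt : k + t ≤ n)
    (C : Submodule F (Fin m × Fin n → F))
    (hdim : Module.finrank F C = m * k)
    (hsub : ∀ c ∈ C, ∀ b : Fin m,
      (fun i : Fin n => c (b, i)) ≠ 0 →
      n - k - t + 1 ≤ hammingNorm (fun i : Fin n => c (b, i))) :
    ∃ c ∈ C, c ≠ 0 ∧ hammingNorm c ≤ n - k + (m - 1) * t + 1 := by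
  classical
  obtain ⟨l, rfl⟩ : ∃ l, m = l + 1 := ⟨m - 1, by omega⟩
  simp only [Nat.add_sub_cancel] at hmt ⊢
  set r := k - 1 - l * t with hr
  let S : Finset (Fin (l+1) × Fin n) :=
    (Finset.univ.filter (fun b : Fin (l+1) => b.val < l)) ×ˢ
      (Finset.univ.filter (fun i : Fin n => i.val < k + t)) ∪
    {Fin.last l} ×ˢ (Finset.univ.filter (fun i : Fin n => i.val < r))
  have hS : S.card < (l + 1) * k := by
    have h1 : S.card ≤ l * (k + t) + r := by
      refine (Finset.card_union_le _ _).trans ?_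
      rw [Finset.card_product, Finset.card_product, Finset.card_singleton, one_mul]
      exact Nat.add_le_add (Nat.mul_le_mul (aux_card_lt _ _) (aux_card_lt _ _)) (aux_card_lt _ _)
    have h2 : l * (k + t) = l * k + l * t := by ring
    have h3 : (l + 1) * k = l * k + k := by ring
    omega
  let f : C →ₗ[F] (S → F) := (LinearMap.funLeft F F (fun x : S => x.val)).comp C.subtype
  have hker : LinearMap.ker f ≠ ⊥ := by
    apply LinearMap.ker_ne_bot_of_finrank_lt
    rw [hdim, Module.finrank_fintype_fun_eq_card, Fintype.card_coe]
    exact hS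
  obtain ⟨⟨c, hc⟩, hcf, hc0⟩ := (Submodule.ne_bot_iff _).1 hker
  have hz : ∀ x ∈ S, c x = 0 := by
    intro x hx
    exact congrFun (LinearMap.mem_ker.1 hcf) ⟨x, hx⟩
  have hblock : ∀ b : Fin (l+1), b.val < l → ∀ i, c (b, i) = 0 := by
    intro b hb i
    by_contra hne
    have h1 := hsub c hc b (fun h => hne (congrFun h i))
    have h2 := aux_weight n (k + t) (fun i => c (b, i)) (fun i hi => hz _ (by simp [S, hb, hi]))
    omega
  refine ⟨c, hc, fun h => hc0 (Subtype.ext h), ?_⟩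
  have hw := aux_weight n r (fun i => c (Fin.last l, i)) (fun i hi => hz _ (by simp [S, hi]))
  have hle : hammingNorm c ≤ hammingNorm (fun i => c (Fin.last l, i)) := by
    unfold hammingNorm
    have hlast : ∀ x : Fin (l+1) × Fin n, c x ≠ 0 → x.1 = Fin.last l := by
      intro x hx
      by_contra hne
      exact hx (hblock x.1 (Fin.val_lt_last hne) x.2)
    refine Finset.card_le_card_of_injOn (fun x => x.2) ?_ ?_
    · intro x hx
      have hx' : c x ≠ 0 := by simpa using hx
      have := hlast x hx'
      simp only [Finset.coe_filter, Finset.mem_univ, true_and, Set.mem_setOf_eq]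
      rw [← this]
      exact hx'
    · intro x hx y hy h
      exact Prod.ext ((hlast x (by simpa using hx)).trans (hlast y (by simpa using hy)).symm) h
  omega
end

section
/- For every information vector of the code C3 and every j ∈ {1,2,3}, if sub-block j of the resulting codeword is not the zero vector, then the Hamming weight of sub-block j is at least n - k - t + 1. (That is, C3 has sub-block minimum distance at least n - k - t + 1.) -/
open Polynomial

theorem degree_shift_lt {F : Type*} [Field F] (f : F[X]) (a b m : ℕ)
    (hf : f.degree < (a : WithBot ℕ)) (h : b + a ≤ m) :
    (X ^ b * f).degree < (m : WithBot ℕ) := by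
  rw [degree_lt_iff_coeff_zero] at hf ⊢
  intro i hi
  rw [coeff_X_pow_mul']
  split_ifs with hb
  · exact hf _ (by omega)
  · rfl

/-- Proposition 1: the code `C3` has sub-block minimum distance at least `n - k - t + 1`:
every nonzero sub-block of a codeword has Hamming weight at least `n - k - t + 1`. -/
theorem C3_subblock_distance
    (F : Type*) [Field F] [Fintype F] [DecidableEq F]
    (n k t : ℕ) (hn : 0 < n) (hk : 0 < k) (ht : 0 < t)
    (h2t : 2 * t < k) (hkt : k + t ≤ n)
    (hdvd : n ∣ Fintype.card F - 1)
    (α : F) (hα : orderOf α = n)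
    -- the information vector: for each sub-unit j, polynomials V_{j,1}, V_{j,2}
    -- of degree ≤ t-1 and V_{j,I} of degree ≤ k-2t-1
    (V1 V2 VI : Fin 3 → F[X])
    (hV1 : ∀ j, (V1 j).degree < (t : WithBot ℕ))
    (hV2 : ∀ j, (V2 j).degree < (t : WithBot ℕ))
    (hVI : ∀ j, (VI j).degree < ((k - 2 * t : ℕ) : WithBot ℕ))
    -- the sub-block polynomials c_j
    (c : Fin 3 → F[X])
    (hc : ∀ j, c j = V1 j + X ^ t * V2 j + X ^ (2 * t) * VI j
          + X ^ k * (V1 (j + 1) + V2 (j + 2)))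
    -- the sub-blocks of the codeword: evaluations of c_j at α^0, …, α^{n-1}
    (w : Fin 3 → Fin n → F)
    (hw : ∀ j (i : Fin n), w j i = (c j).eval (α ^ (i : ℕ))) :
    ∀ j : Fin 3, w j ≠ 0 → n - k - t + 1 ≤ hammingNorm (w j) := by
  intro j hj
  have hdeg : (c j).degree < ((k + t : ℕ) : WithBot ℕ) := by
    have e1 := degree_shift_lt (V1 j) t 0 (k + t) (hV1 j) (by omega)
    have e2 := degree_shift_lt (V2 j) t t (k + t) (hV2 j) (by omega)
    have e3 := degree_shift_lt (VI j) (k - 2 * t) (2 * t) (k + t) (hVI j) (by omega)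
    have e4 := degree_shift_lt (V1 (j + 1)) t k (k + t) (hV1 _) (by omega)
    have e5 := degree_shift_lt (V2 (j + 2)) t k (k + t) (hV2 _) (by omega)
    rw [pow_zero, one_mul] at e1
    rw [← mem_degreeLT] at *
    rw [hc j, mul_add]
    exact add_mem (add_mem (add_mem e1 e2) e3) (add_mem e4 e5)
  have hc0 : c j ≠ 0 := by
    intro h0
    apply hj
    funext i
    simp [hw, h0]
  have hnat : (c j).natDegree < k + t := (natDegree_lt_iff_degree_lt hc0).2 hdeg
  have hinj : Function.Injective (fun i : Fin n => α ^ (i : ℕ)) := by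
    intro a b hab
    apply Fin.ext
    exact pow_injOn_Iio_orderOf (by simp [hα]) (by simp [hα]) hab
  have hz : (Finset.univ.filter (fun i : Fin n => w j i = 0)).card ≤ (c j).natDegree := by
    rw [← Finset.card_image_of_injective _ hinj]
    apply card_le_degree_of_subset_roots
    intro x hx
    simp only [Finset.mem_val, Finset.mem_image, Finset.mem_filter, Finset.mem_univ,
      true_and] at hx
    obtain ⟨i, hi, rfl⟩ := hx
    rw [mem_roots hc0, IsRoot, ← hw, hi]
  have hs := Finset.card_filter_add_card_filter_not (s := (Finset.univ : Finset (Fin n)))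
    (fun i : Fin n => w j i = 0)
  have hh : hammingNorm (w j) = (Finset.univ.filter (fun i : Fin n => ¬ w j i = 0)).card := rfl
  rw [Finset.card_univ, Fintype.card_fin] at hs
  omega
end

section
/- Let a codeword of C3 have exactly one of its three sub-blocks nonzero. Then the Hamming weight of the codeword is at least n - k + 2t + 1. (That is, the D_1-minimum-distance of C3 is at least n - k + 2t + 1.) -/
open Polynomial

theorem c3_split {F : Type*} [Field F] (m : ℕ) (A B : F[X]) (hA : A.degree < (m : WithBot ℕ))
    (h : A + X ^ m * B = 0) : A = 0 ∧ B = 0 := by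
  have hB : B = 0 := by
    ext i
    have h1 := congrArg (fun p : F[X] => p.coeff (i + m)) h
    have h2 : A.coeff (i + m) = 0 := coeff_eq_zero_of_degree_lt
      (lt_of_lt_of_le hA (by exact_mod_cast Nat.le_add_left m i))
    simpa [h2, coeff_X_pow_mul] using h1
  subst hB
  simpa using h

theorem c3_zeros {F : Type*} [Field F] [DecidableEq F] (n : ℕ) (α : F) (hα : orderOf α = n)
    (p : F[X]) (hp : p ≠ 0) :
    (Finset.univ.filter fun i : Fin n => p.eval (α ^ (i : ℕ)) = 0).card ≤ p.natDegree := by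
  refine le_trans ?_ (le_trans (Multiset.toFinset_card_le p.roots) (card_roots' p))
  refine Finset.card_le_card_of_injOn (fun i : Fin n => α ^ (i : ℕ)) ?_ ?_
  · intro i hi
    simpa [hp] using hi
  · intro i _ j _ hij
    apply Fin.ext
    exact pow_injOn_Iio_orderOf (by simp [hα]) (by simp [hα]) hij

theorem c3_weight {F : Type*} [Field F] [DecidableEq F] (n : ℕ) (α : F) (hα : orderOf α = n)
    (p : F[X]) (hp : p ≠ 0) (w : Fin n → F) (hw : ∀ i : Fin n, w i = p.eval (α ^ (i : ℕ))) :
    n ≤ hammingNorm w + p.natDegree := by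
  have h1 := c3_zeros n α hα p hp
  have h2 := Finset.card_filter_add_card_filter_not (s := (Finset.univ : Finset (Fin n)))
    (fun i : Fin n => p.eval (α ^ (i : ℕ)) = 0)
  have h3 : hammingNorm w
      = (Finset.univ.filter fun i : Fin n => ¬ p.eval (α ^ (i : ℕ)) = 0).card := by
    simp [hammingNorm, hw]
  simp only [Finset.card_univ, Fintype.card_fin] at h2
  omega

theorem c3_deg {F : Type*} [Field F] (m d e : ℕ) (A B : F[X]) (hA : A.degree < (m : WithBot ℕ))
    (hB : B.degree < (d : WithBot ℕ)) (he : m + d = e) :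
    (A + X ^ m * B).degree < (e : WithBot ℕ) := by
  subst he
  rw [degree_lt_iff_coeff_zero] at *
  intro i hi
  rw [coeff_add, coeff_X_pow_mul', hA i (by omega), if_pos (by omega), hB _ (by omega), add_zero]

/-- Lemma 1: if a codeword of `C3` has exactly one nonzero sub-block, then its Hamming weight
is at least `n - k + 2t + 1` (the D₁-minimum-distance of `C3`). -/
theorem C3_D1_distance
    (F : Type*) [Field F] [Fintype F] [DecidableEq F]
    (n k t : ℕ) (hn : 0 < n) (hk : 0 < k) (ht : 0 < t)
    (h2t : 2 * t < k) (hkt : k + t ≤ n)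
    (hdvd : n ∣ Fintype.card F - 1)
    (α : F) (hα : orderOf α = n)
    -- the information vector: for each sub-unit j, polynomials V_{j,1}, V_{j,2}
    -- of degree ≤ t-1 and V_{j,I} of degree ≤ k-2t-1
    (V1 V2 VI : Fin 3 → F[X])
    (hV1 : ∀ j, (V1 j).degree < (t : WithBot ℕ))
    (hV2 : ∀ j, (V2 j).degree < (t : WithBot ℕ))
    (hVI : ∀ j, (VI j).degree < ((k - 2 * t : ℕ) : WithBot ℕ))
    -- the sub-block polynomials c_j
    (c : Fin 3 → F[X])
    (hc : ∀ j, c j = V1 j + X ^ t * V2 j + X ^ (2 * t) * VI j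
          + X ^ k * (V1 (j + 1) + V2 (j + 2)))
    -- the sub-blocks of the codeword: evaluations of c_j at α^0, …, α^{n-1}
    (w : Fin 3 → Fin n → F)
    (hw : ∀ j (i : Fin n), w j i = (c j).eval (α ^ (i : ℕ)))
    (hone : (Finset.univ.filter fun j : Fin 3 => w j ≠ 0).card = 1) :
    n - k + 2 * t + 1 ≤ ∑ j : Fin 3, hammingNorm (w j) := by
  have hz : ∀ j, w j = 0 → V1 j = 0 ∧ V2 j = 0 ∧ VI j = 0 ∧ V1 (j + 1) + V2 (j + 2) = 0 := by
    intro j hj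
    have d1 := c3_deg t t (2 * t) _ _ (hV1 j) (hV2 j) (by omega)
    have d2 := c3_deg (2 * t) (k - 2 * t) k _ _ d1 (hVI j) (by omega)
    have d3 := c3_deg k t (k + t) _ (V1 (j + 1) + V2 (j + 2)) d2
      (lt_of_le_of_lt (degree_add_le _ _) (max_lt (hV1 _) (hV2 _))) rfl
    rw [← hc j] at d3
    have h0 : c j = 0 := by
      by_contra hne
      have h1 := c3_weight n α hα (c j) hne (w j) (hw j)
      have h2 := (natDegree_lt_iff_degree_lt hne).2 d3
      rw [hj, hammingNorm_zero] at h1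
      omega
    rw [hc j] at h0
    obtain ⟨e1, f1⟩ := c3_split k _ _ d2 h0
    obtain ⟨e2, f2⟩ := c3_split (2 * t) _ _ d1 e1
    obtain ⟨e3, f3⟩ := c3_split t _ _ (hV1 j) e2
    exact ⟨e3, f3, f2, f1⟩
  obtain ⟨j, hj⟩ := Finset.card_eq_one.1 hone
  have hmem : ∀ i, w i ≠ 0 ↔ i = j := by
    intro i
    have := Finset.ext_iff.1 hj i
    simpa using this
  have hwj : w j ≠ 0 := (hmem j).2 rfl
  have a1 : w (j + 1) = 0 := by
    by_contra h
    exact absurd ((hmem _).1 h) (by clear * -; decide +revert)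
  have a2 : w (j + 2) = 0 := by
    by_contra h
    exact absurd ((hmem _).1 h) (by clear * -; decide +revert)
  obtain ⟨p1, p2, -, p4⟩ := hz _ a1
  obtain ⟨q1, q2, -, q4⟩ := hz _ a2
  have i1 : j + 1 + 1 = j + 2 := by clear * -; decide +revert
  have i2 : j + 1 + 2 = j := by clear * -; decide +revert
  have i3 : j + 2 + 1 = j := by clear * -; decide +revert
  have i4 : j + 2 + 2 = j + 1 := by clear * -; decide +revert
  rw [i1, i2, q1, zero_add] at p4
  rw [i3, i4, p2, add_zero] at q4
  have hcj : c j = X ^ (2 * t) * VI j := by rw [hc j, p4, q4, p1, q2]; simp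
  have hα0 : α ≠ 0 := by
    rintro rfl
    simp at hα
    omega
  have hVne : VI j ≠ 0 := by
    intro h
    apply hwj
    ext i
    simp [hw, hcj, h]
  have hdeg := (natDegree_lt_iff_degree_lt hVne).2 (hVI j)
  have hwt := c3_weight n α hα (VI j) hVne (fun i => (VI j).eval (α ^ (i : ℕ))) (fun _ => rfl)
  have heq : hammingNorm (w j) = hammingNorm (fun i : Fin n => (VI j).eval (α ^ (i : ℕ))) := by
    simp [hammingNorm, hw, hcj, hα0]
  have hle : hammingNorm (w j) ≤ ∑ j : Fin 3, hammingNorm (w j) :=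
    Finset.single_le_sum (f := fun j => hammingNorm (w j)) (fun _ _ => Nat.zero_le _)
      (Finset.mem_univ j)
  omega
end

section
/- Let a codeword of C3 have exactly two of its three sub-blocks nonzero. Then the Hamming weight of the codeword is at least 2(n - k - t + 1). (That is, the D_2-minimum-distance of C3 is at least 2(n - k - t + 1).) -/
open Polynomial

/-- Lemma 2: if a codeword of `C3` has exactly two nonzero sub-blocks, then its Hamming weight
is at least `2(n - k - t + 1)` (the D₂-minimum-distance of `C3`). -/
theorem C3_D2_distance
    (F : Type*) [Field F] [Fintype F] [DecidableEq F]
    (n k t : ℕ) (hn : 0 < n) (hk : 0 < k) (ht : 0 < t)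
    (h2t : 2 * t < k) (hkt : k + t ≤ n)
    (hdvd : n ∣ Fintype.card F - 1)
    (α : F) (hα : orderOf α = n)
    -- the information vector: for each sub-unit j, polynomials V_{j,1}, V_{j,2}
    -- of degree ≤ t-1 and V_{j,I} of degree ≤ k-2t-1
    (V1 V2 VI : Fin 3 → F[X])
    (hV1 : ∀ j, (V1 j).degree < (t : WithBot ℕ))
    (hV2 : ∀ j, (V2 j).degree < (t : WithBot ℕ))
    (hVI : ∀ j, (VI j).degree < ((k - 2 * t : ℕ) : WithBot ℕ))
    -- the sub-block polynomials c_j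
    (c : Fin 3 → F[X])
    (hc : ∀ j, c j = V1 j + X ^ t * V2 j + X ^ (2 * t) * VI j
          + X ^ k * (V1 (j + 1) + V2 (j + 2)))
    -- the sub-blocks of the codeword: evaluations of c_j at α^0, …, α^{n-1}
    (w : Fin 3 → Fin n → F)
    (hw : ∀ j (i : Fin n), w j i = (c j).eval (α ^ (i : ℕ)))
    (htwo : (Finset.univ.filter fun j : Fin 3 => w j ≠ 0).card = 2) :
    2 * (n - k - t + 1) ≤ ∑ j : Fin 3, hammingNorm (w j) := by
  have hdeg : ∀ j, (c j).natDegree < k + t := by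
    intro j
    have nd : ∀ (p : F[X]) (m : ℕ), 0 < m → p.degree < (m : WithBot ℕ) → p.natDegree < m := by
      intro p m hm hp
      by_cases h0 : p = 0
      · simpa [h0] using hm
      · exact (natDegree_lt_iff_degree_lt h0).mpr hp
    have h1 := fun j => nd _ _ ht (hV1 j)
    have h2 := fun j => nd _ _ ht (hV2 j)
    have h3 := nd _ _ (by omega) (hVI j)
    have a1 : (X ^ t * V2 j).natDegree ≤ t + (V2 j).natDegree :=
      natDegree_mul_le.trans (by simp)
    have a2 : (X ^ (2 * t) * VI j).natDegree ≤ 2 * t + (VI j).natDegree :=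
      natDegree_mul_le.trans (by simp)
    have a3 : (X ^ k * (V1 (j + 1) + V2 (j + 2))).natDegree
        ≤ k + (V1 (j + 1) + V2 (j + 2)).natDegree :=
      natDegree_mul_le.trans (by simp)
    have b1 := natDegree_add_le (V1 (j + 1)) (V2 (j + 2))
    have b2 := natDegree_add_le (V1 j) (X ^ t * V2 j)
    have b3 := natDegree_add_le (V1 j + X ^ t * V2 j) (X ^ (2 * t) * VI j)
    have b4 := natDegree_add_le (V1 j + X ^ t * V2 j + X ^ (2 * t) * VI j)
      (X ^ k * (V1 (j + 1) + V2 (j + 2)))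
    rw [← hc j] at b4
    have e1 := h1 j
    have e2 := h1 (j + 1)
    have e3 := h2 j
    have e4 := h2 (j + 2)
    omega
  have key : ∀ j, w j ≠ 0 → n - k - t + 1 ≤ hammingNorm (w j) := by
    intro j hj
    have hc0 : c j ≠ 0 := by
      intro h
      apply hj
      funext i
      simp [hw, h]
    have hz : (Finset.univ.filter fun i : Fin n => w j i = 0).card ≤ (c j).natDegree := by
      refine le_trans ?_ ((Multiset.toFinset_card_le _).trans (card_roots' (c j)))
      refine Finset.card_le_card_of_injOn (fun i : Fin n => α ^ (i : ℕ)) ?_ ?_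
      · intro i hi
        have hi' : w j i = 0 := by simpa using hi
        rw [hw] at hi'
        simp [hc0, hi']
      · intro a _ b _ hab
        apply Fin.ext
        exact pow_injOn_Iio_orderOf (by simp [hα]) (by simp [hα]) hab
    have hs := Finset.card_filter_add_card_filter_not (s := (Finset.univ : Finset (Fin n)))
      (fun i => w j i = 0)
    have hh : hammingNorm (w j) = (Finset.univ.filter fun i : Fin n => ¬ w j i = 0).card := rfl
    have := hdeg j
    simp only [Finset.card_univ, Fintype.card_fin] at hs
    omega
  calc 2 * (n - k - t + 1)
      = ∑ j ∈ Finset.univ.filter (fun j : Fin 3 => w j ≠ 0), (n - k - t + 1) := by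
        rw [Finset.sum_const, htwo, smul_eq_mul]
    _ ≤ ∑ j ∈ Finset.univ.filter (fun j : Fin 3 => w j ≠ 0), hammingNorm (w j) :=
        Finset.sum_le_sum fun j hj => key j (Finset.mem_filter.mp hj).2
    _ ≤ ∑ j : Fin 3, hammingNorm (w j) :=
        Finset.sum_le_sum_of_subset (Finset.filter_subset _ _)
end

section
/- The code C3 admits sub-block reverse mapping: for every j ∈ {1,2,3}, if two information vectors produce C3 codewords whose sub-blocks j are equal (as vectors in F^n), then the two information vectors have the same sub-unit j, i.e., V_{j,1} = V'_{j,1}, V_{j,2} = V'_{j,2}, and V_{j,I} = V'_{j,I}. In particular, the k information symbols of sub-unit j are uniquely determined by sub-block j of the codeword. -/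
open Polynomial

/-- `C3` admits sub-block reverse mapping: if two information vectors produce codewords
whose sub-blocks `j` agree, then their sub-units `j` agree. -/
theorem C3_reverse_mapping
    (F : Type*) [Field F] [Fintype F] [DecidableEq F]
    (n k t : ℕ) (hn : 0 < n) (hk : 0 < k) (ht : 0 < t)
    (h2t : 2 * t < k) (hkt : k + t ≤ n)
    (hdvd : n ∣ Fintype.card F - 1)
    (α : F) (hα : orderOf α = n)
    -- the information vector: for each sub-unit j, polynomials V_{j,1}, V_{j,2}
    -- of degree ≤ t-1 and V_{j,I} of degree ≤ k-2t-1
    (V1 V2 VI : Fin 3 → F[X])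
    (hV1 : ∀ j, (V1 j).degree < (t : WithBot ℕ))
    (hV2 : ∀ j, (V2 j).degree < (t : WithBot ℕ))
    (hVI : ∀ j, (VI j).degree < ((k - 2 * t : ℕ) : WithBot ℕ))
    -- the sub-block polynomials c_j
    (c : Fin 3 → F[X])
    (hc : ∀ j, c j = V1 j + X ^ t * V2 j + X ^ (2 * t) * VI j
          + X ^ k * (V1 (j + 1) + V2 (j + 2)))
    -- the sub-blocks of the codeword: evaluations of c_j at α^0, …, α^{n-1}
    (w : Fin 3 → Fin n → F)
    (hw : ∀ j (i : Fin n), w j i = (c j).eval (α ^ (i : ℕ)))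
    (V1' V2' VI' : Fin 3 → F[X])
    (hV1' : ∀ j, (V1' j).degree < (t : WithBot ℕ))
    (hV2' : ∀ j, (V2' j).degree < (t : WithBot ℕ))
    (hVI' : ∀ j, (VI' j).degree < ((k - 2 * t : ℕ) : WithBot ℕ))
    (c' : Fin 3 → F[X])
    (hc' : ∀ j, c' j = V1' j + X ^ t * V2' j + X ^ (2 * t) * VI' j
          + X ^ k * (V1' (j + 1) + V2' (j + 2)))
    (w' : Fin 3 → Fin n → F)
    (hw' : ∀ j (i : Fin n), w' j i = (c' j).eval (α ^ (i : ℕ))) :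
    ∀ j : Fin 3, w j = w' j → V1 j = V1' j ∧ V2 j = V2' j ∧ VI j = VI' j := by
  intro j hj
  have z : ∀ (p : F[X]) (m : ℕ), p.degree < (m : WithBot ℕ) → ∀ d, m ≤ d → p.coeff d = 0 :=
    fun p m h => (degree_lt_iff_coeff_zero p m).1 h
  have hcc : ∀ d, (c j).coeff d = (V1 j).coeff d + (if t ≤ d then (V2 j).coeff (d - t) else 0)
      + (if 2 * t ≤ d then (VI j).coeff (d - 2 * t) else 0)
      + (if k ≤ d then (V1 (j+1)).coeff (d - k) + (V2 (j+2)).coeff (d - k) else 0) := by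
    intro d
    rw [hc j]
    simp only [coeff_add, coeff_X_pow_mul']
  have hcc' : ∀ d, (c' j).coeff d = (V1' j).coeff d
      + (if t ≤ d then (V2' j).coeff (d - t) else 0)
      + (if 2 * t ≤ d then (VI' j).coeff (d - 2 * t) else 0)
      + (if k ≤ d then (V1' (j+1)).coeff (d - k) + (V2' (j+2)).coeff (d - k) else 0) := by
    intro d
    rw [hc' j]
    simp only [coeff_add, coeff_X_pow_mul']
  have hdeg : (c j).degree < (n : WithBot ℕ) := by
    rw [degree_lt_iff_coeff_zero]
    intro d hd
    rw [hcc, z _ _ (hV1 j) d (by omega), z _ _ (hV2 j) (d - t) (by omega),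
      z _ _ (hVI j) (d - 2 * t) (by omega), z _ _ (hV1 (j+1)) (d - k) (by omega),
      z _ _ (hV2 (j+2)) (d - k) (by omega)]
    simp
  have hdeg' : (c' j).degree < (n : WithBot ℕ) := by
    rw [degree_lt_iff_coeff_zero]
    intro d hd
    rw [hcc', z _ _ (hV1' j) d (by omega), z _ _ (hV2' j) (d - t) (by omega),
      z _ _ (hVI' j) (d - 2 * t) (by omega), z _ _ (hV1' (j+1)) (d - k) (by omega),
      z _ _ (hV2' (j+2)) (d - k) (by omega)]
    simp
  have heq : c j = c' j := by
    apply eq_of_degrees_lt_of_eval_index_eq (v := fun i : ℕ => α ^ i) (Finset.range n)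
    · intro a ha b hb hab
      subst hα
      exact pow_injOn_Iio_orderOf (by simpa using ha) (by simpa using hb) hab
    · simpa using hdeg
    · simpa using hdeg'
    · intro i hi
      have h := congrFun hj ⟨i, Finset.mem_range.1 hi⟩
      rw [hw, hw'] at h
      exact h
  have key := fun d => (hcc d).symm.trans ((congrArg (fun p => coeff p d) heq).trans (hcc' d))
  refine ⟨?_, ?_, ?_⟩
  · ext d
    by_cases hd : d < t
    · have h := key d
      simpa [show ¬ t ≤ d by omega, show ¬ 2 * t ≤ d by omega, show ¬ k ≤ d by omega] using h
    · rw [z _ _ (hV1 j) d (by omega), z _ _ (hV1' j) d (by omega)]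
  · ext d
    by_cases hd : d < t
    · have h := key (d + t)
      simpa [show ¬ 2 * t ≤ d + t by omega, show ¬ k ≤ d + t by omega,
        z _ _ (hV1 j) (d + t) (by omega), z _ _ (hV1' j) (d + t) (by omega)] using h
    · rw [z _ _ (hV2 j) d (by omega), z _ _ (hV2' j) d (by omega)]
  · ext d
    by_cases hd : d < k - 2 * t
    · have h := key (d + 2 * t)
      simpa [show ¬ k ≤ d + 2 * t by omega, show t ≤ d + 2 * t by omega,
        z _ _ (hV1 j) (d + 2 * t) (by omega), z _ _ (hV1' j) (d + 2 * t) (by omega),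
        z _ _ (hV2 j) (d + 2 * t - t) (by omega),
        z _ _ (hV2' j) (d + 2 * t - t) (by omega)] using h
    · rw [z _ _ (hVI j) d (by omega), z _ _ (hVI' j) d (by omega)]
end

section
/- For every information vector of the code K3 and every j ∈ {1,2,3}, if sub-block j of the resulting codeword is not the zero vector, then the Hamming weight of sub-block j is at least n - k - 2s + 1. (That is, with t = 2s, the code K3 has sub-block minimum distance at least n - k - t + 1.) -/
open Polynomial

lemma K3_aux_mem {F : Type*} [Field F] {p : F[X]} {d m N : ℕ}
    (hp : p.degree < (d : WithBot ℕ)) (h : m + d ≤ N) : X ^ m * p ∈ degreeLT F N := by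
  rw [mem_degreeLT, degree_lt_iff_coeff_zero]
  intro i hi
  rw [coeff_X_pow_mul']
  split_ifs
  · exact (degree_lt_iff_coeff_zero p d).1 hp _ (by omega)
  · rfl

/-- Proposition 2: the code `K3` has sub-block minimum distance at least `n - k - 2s + 1`:
every nonzero sub-block of a codeword has Hamming weight at least `n - k - 2s + 1`. -/
theorem K3_subblock_distance
    (F : Type*) [Field F] [Fintype F] [DecidableEq F]
    (n k s : ℕ) (hn : 0 < n) (hk : 0 < k) (hs : 0 < s)
    (h4s : 4 * s < k) (hks : k + 2 * s ≤ n)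
    (hdvd : n ∣ Fintype.card F - 1)
    (α : F) (hα : orderOf α = n)
    -- the information vector: for each sub-unit j, polynomials V_{j,1},…,V_{j,4}
    -- of degree ≤ s-1 and V_{j,I} of degree ≤ k-4s-1
    (V1 V2 V3 V4 VI : Fin 3 → F[X])
    (hV1 : ∀ j, (V1 j).degree < (s : WithBot ℕ))
    (hV2 : ∀ j, (V2 j).degree < (s : WithBot ℕ))
    (hV3 : ∀ j, (V3 j).degree < (s : WithBot ℕ))
    (hV4 : ∀ j, (V4 j).degree < (s : WithBot ℕ))
    (hVI : ∀ j, (VI j).degree < ((k - 4 * s : ℕ) : WithBot ℕ))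
    -- the sub-block polynomials c_j (indices of sub-units taken mod 3)
    (c : Fin 3 → F[X])
    (hc : ∀ j, c j = V1 j + X ^ s * V2 j + X ^ (2 * s) * (V3 j + V4 j)
          + X ^ (3 * s) * V4 j + X ^ (4 * s) * VI j
          + X ^ k * (V2 (j - 1) + V3 (j + 1) + V4 (j + 1))
          + X ^ (k + s) * V1 (j - 1))
    -- the sub-blocks of the codeword: evaluations of c_j at α^0, …, α^{n-1}
    (w : Fin 3 → Fin n → F)
    (hw : ∀ j (i : Fin n), w j i = (c j).eval (α ^ (i : ℕ))) :
    ∀ j : Fin 3, w j ≠ 0 → n - k - 2 * s + 1 ≤ hammingNorm (w j) := by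
  intro j hj
  have hdeg : c j ∈ degreeLT F (k + 2 * s) := by
    have h1 : X ^ 0 * V1 j ∈ degreeLT F (k + 2 * s) := K3_aux_mem (hV1 j) (by omega)
    rw [pow_zero, one_mul] at h1
    rw [hc j, mul_add, mul_add, mul_add]
    refine add_mem (add_mem (add_mem (add_mem (add_mem (add_mem h1 ?_) (add_mem ?_ ?_)) ?_) ?_)
      (add_mem (add_mem ?_ ?_) ?_)) ?_
    · exact K3_aux_mem (hV2 _) (by omega)
    · exact K3_aux_mem (hV3 _) (by omega)
    · exact K3_aux_mem (hV4 _) (by omega)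
    · exact K3_aux_mem (hV4 _) (by omega)
    · exact K3_aux_mem (hVI _) (by omega)
    · exact K3_aux_mem (hV2 _) (by omega)
    · exact K3_aux_mem (hV3 _) (by omega)
    · exact K3_aux_mem (hV4 _) (by omega)
    · exact K3_aux_mem (hV1 _) (by omega)
  have hc0 : c j ≠ 0 := by
    intro h
    apply hj
    funext i
    simp [hw, h]
  have hnd : (c j).natDegree < k + 2 * s :=
    (natDegree_lt_iff_degree_lt hc0).2 (mem_degreeLT.1 hdeg)
  have hinj : Function.Injective (fun i : Fin n => α ^ (i : ℕ)) := by
    intro a b hab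
    have := pow_injOn_Iio_orderOf (x := α) (by simp [hα]) (by simp [hα]) hab
    exact Fin.ext this
  have hz : (Finset.univ.filter (fun i => w j i = 0)).card ≤ (c j).natDegree := by
    rw [← Finset.card_image_of_injective _ hinj]
    refine card_le_degree_of_subset_roots ?_
    intro x hx
    simp only [Finset.mem_val, Finset.mem_image, Finset.mem_filter, Finset.mem_univ,
      true_and] at hx
    obtain ⟨i, hi, rfl⟩ := hx
    rw [mem_roots hc0, IsRoot.def, ← hw, hi]
  have hsum := Finset.card_filter_add_card_filter_not (s := (Finset.univ : Finset (Fin n)))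
    (fun i => w j i = 0)
  rw [Finset.card_univ, Fintype.card_fin] at hsum
  have hnorm : hammingNorm (w j) = (Finset.univ.filter (fun i => ¬ w j i = 0)).card := rfl
  omega
end

section
/- Let a codeword of K3 have exactly two of its three sub-blocks nonzero. Then the Hamming weight of the codeword is at least 2(n - k - s + 1). (That is, with t = 2s, the D_2-minimum-distance of K3 is at least 2(n - k - t/2 + 1).) -/
open Polynomial

lemma K3_split {F : Type*} [Field F] {A B : F[X]} {d : ℕ}
    (hA : A.degree < (d : WithBot ℕ)) (h : A + X ^ d * B = 0) : A = 0 ∧ B = 0 := by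
  have hB : B = 0 := by
    by_contra hB
    have h1 : A = - (X ^ d * B) := eq_neg_of_add_eq_zero_left h
    rw [h1, degree_neg, degree_mul, degree_X_pow, degree_eq_natDegree hB] at hA
    have : d + B.natDegree < d := by exact_mod_cast hA
    omega
  subst hB
  simpa using h

lemma K3_deg_add {F : Type*} [Field F] {A B : F[X]} {d e m : ℕ}
    (hA : A.degree < (d : WithBot ℕ)) (hB : B.degree < (e : WithBot ℕ)) (h : d + e = m) :
    (A + X ^ d * B).degree < (m : WithBot ℕ) := by
  subst h
  refine (degree_add_le _ _).trans_lt (max_lt (hA.trans_le (by exact_mod_cast Nat.le_add_right _ _)) ?_)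
  by_cases hB0 : B = 0
  · subst hB0
    simp [WithBot.bot_lt_coe]
  rw [degree_mul, degree_X_pow, degree_eq_natDegree hB0]
  rw [degree_eq_natDegree hB0] at hB
  have : B.natDegree < e := by exact_mod_cast hB
  exact_mod_cast Nat.add_lt_add_left this d

lemma K3_weight {F : Type*} [Field F] [DecidableEq F] {n m : ℕ} {α : F} (hα : orderOf α = n)
    {q : F[X]} (hq : q ≠ 0) (hd : q.degree < (m : WithBot ℕ)) (w : Fin n → F)
    (hw : ∀ i : Fin n, w i = 0 → q.eval (α ^ (i : ℕ)) = 0) : n + 1 ≤ hammingNorm w + m := by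
  have h1 : (Finset.univ.filter fun i => w i = 0).card ≤ q.roots.toFinset.card := by
    apply Finset.card_le_card_of_injOn (fun i : Fin n => α ^ (i : ℕ))
    · intro i hi
      simp only [Finset.coe_filter, Finset.mem_univ, true_and, Set.mem_setOf_eq] at hi
      simpa [hq] using hw i hi
    · intro i _ j _ hij
      apply Fin.ext
      exact pow_injOn_Iio_orderOf (by simp [hα]) (by simp [hα]) hij
  have h2 := (Multiset.toFinset_card_le q.roots).trans (card_roots' q)
  have h3 : q.natDegree < m := by
    rw [degree_eq_natDegree hq] at hd
    exact_mod_cast hd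
  have h4 : (Finset.univ.filter fun i => w i = 0).card + hammingNorm w = n := by
    have := Finset.card_filter_add_card_filter_not (s := (Finset.univ : Finset (Fin n)))
      (fun i => w i = 0)
    simpa [hammingNorm] using this
  omega

/-- Lemma 4: if a codeword of `K3` has exactly two nonzero sub-blocks, then its Hamming weight
is at least `2(n - k - s + 1)` (the D₂-minimum-distance of `K3`). -/
theorem K3_D2_distance
    (F : Type*) [Field F] [Fintype F] [DecidableEq F]
    (n k s : ℕ) (hn : 0 < n) (hk : 0 < k) (hs : 0 < s)
    (h4s : 4 * s < k) (hks : k + 2 * s ≤ n)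
    (hdvd : n ∣ Fintype.card F - 1)
    (α : F) (hα : orderOf α = n)
    -- the information vector: for each sub-unit j, polynomials V_{j,1},…,V_{j,4}
    -- of degree ≤ s-1 and V_{j,I} of degree ≤ k-4s-1
    (V1 V2 V3 V4 VI : Fin 3 → F[X])
    (hV1 : ∀ j, (V1 j).degree < (s : WithBot ℕ))
    (hV2 : ∀ j, (V2 j).degree < (s : WithBot ℕ))
    (hV3 : ∀ j, (V3 j).degree < (s : WithBot ℕ))
    (hV4 : ∀ j, (V4 j).degree < (s : WithBot ℕ))
    (hVI : ∀ j, (VI j).degree < ((k - 4 * s : ℕ) : WithBot ℕ))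
    -- the sub-block polynomials c_j (indices of sub-units taken mod 3)
    (c : Fin 3 → F[X])
    (hc : ∀ j, c j = V1 j + X ^ s * V2 j + X ^ (2 * s) * (V3 j + V4 j)
          + X ^ (3 * s) * V4 j + X ^ (4 * s) * VI j
          + X ^ k * (V2 (j - 1) + V3 (j + 1) + V4 (j + 1))
          + X ^ (k + s) * V1 (j - 1))
    -- the sub-blocks of the codeword: evaluations of c_j at α^0, …, α^{n-1}
    (w : Fin 3 → Fin n → F)
    (hw : ∀ j (i : Fin n), w j i = (c j).eval (α ^ (i : ℕ)))
    (htwo : (Finset.univ.filter fun j : Fin 3 => w j ≠ 0).card = 2) :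
    2 * (n - k - s + 1) ≤ ∑ j : Fin 3, hammingNorm (w j) := by
  classical
  have hadd : ∀ {A B : F[X]} {d : ℕ}, A.degree < (d : WithBot ℕ) → B.degree < (d : WithBot ℕ) →
      (A + B).degree < (d : WithBot ℕ) := fun hA hB =>
    (degree_add_le _ _).trans_lt (max_lt hA hB)
  -- the partial sums of `c j`
  have d1 := fun j => K3_deg_add (hV1 j) (hV2 j) (show s + s = 2 * s by omega)
  have d2 := fun j => K3_deg_add (d1 j) (hadd (hV3 j) (hV4 j)) (show 2 * s + s = 3 * s by omega)
  have d3 := fun j => K3_deg_add (d2 j) (hV4 j) (show 3 * s + s = 4 * s by omega)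
  have d4 := fun j => K3_deg_add (d3 j) (hVI j) (show 4 * s + (k - 4 * s) = k by omega)
  have d5 := fun j => K3_deg_add (d4 j) (hadd (hadd (hV2 (j - 1)) (hV3 (j + 1))) (hV4 (j + 1)))
    (show k + s = k + s from rfl)
  have d6 := fun j => K3_deg_add (d5 j) (hV1 (j - 1)) (show k + s + s = k + 2 * s by omega)
  obtain ⟨j, hj0, hja, hjb⟩ : ∃ j, w j = 0 ∧ w (j + 1) ≠ 0 ∧ w (j - 1) ≠ 0 := by
    have key : ∀ p : Fin 3 → Bool, (Finset.univ.filter fun j : Fin 3 => p j = true).card = 2 →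
        ∃ j, ¬ p j = true ∧ p (j + 1) = true ∧ p (j - 1) = true := by decide
    simpa using key (fun j => decide (w j ≠ 0)) (by simpa using htwo)
  have hcj : c j = 0 := by
    by_contra h
    have := K3_weight hα h (by rw [hc j]; exact d6 j) (w j) (fun i hi => by rw [← hw, hi])
    rw [hj0, hammingNorm_zero] at this
    omega
  have hne : ∀ i, w i ≠ 0 → c i ≠ 0 := by
    intro i hi h0
    exact hi (funext fun t => by rw [hw, h0]; simp)
  rw [hc j] at hcj
  obtain ⟨h5, z1'⟩ := K3_split (d5 j) hcj
  obtain ⟨h4, -⟩ := K3_split (d4 j) h5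
  obtain ⟨h3, -⟩ := K3_split (d3 j) h4
  obtain ⟨h2, z4⟩ := K3_split (d2 j) h3
  obtain ⟨h1, z34⟩ := K3_split (d1 j) h2
  obtain ⟨z1, z2⟩ := K3_split (hV1 j) h1
  have z3 : V3 j = 0 := by simpa [z4] using z34
  have e1 : j + 1 - 1 = j := by simp
  have e2 : j - 1 + 1 = j := by simp
  have wa : n + 1 ≤ hammingNorm (w (j + 1)) + (k + s) := by
    refine K3_weight hα (hne _ hja) ?_ _ (fun i hi => by rw [← hw, hi])
    have := d5 (j + 1)
    rw [hc (j + 1), e1, z1, mul_zero, add_zero]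
    rwa [e1] at this
  have wb : n + 1 ≤ hammingNorm (w (j - 1)) + (k + s) := by
    have f1 := K3_deg_add (hV2 (j - 1)) (hadd (hV3 (j - 1)) (hV4 (j - 1)))
      (show s + s = 2 * s by omega)
    have f2 := K3_deg_add f1 (hV4 (j - 1)) (show 2 * s + s = 3 * s by omega)
    have f3 := K3_deg_add f2 (hVI (j - 1)) (show 3 * s + (k - 4 * s) = k - s by omega)
    have f4 := K3_deg_add f3 (hV2 (j - 1 - 1)) (show k - s + s = k by omega)
    have f5 := K3_deg_add f4 (hV1 (j - 1 - 1)) (show k + s = k + s from rfl)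
    have hfac : c (j - 1) = X ^ s * (V2 (j - 1) + X ^ s * (V3 (j - 1) + V4 (j - 1))
        + X ^ (2 * s) * V4 (j - 1) + X ^ (3 * s) * VI (j - 1)
        + X ^ (k - s) * V2 (j - 1 - 1) + X ^ k * V1 (j - 1 - 1)) := by
      have hX : (X : F[X]) ^ k = X ^ s * X ^ (k - s) := by
        rw [← pow_add]
        congr 1
        omega
      rw [hc (j - 1), e2, z1', z3, z4, pow_add, hX]
      ring
    have hnb := hne _ hjb
    rw [hfac] at hnb
    refine K3_weight hα (right_ne_zero_of_mul hnb) f5 _ (fun i hi => ?_)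
    rw [hw, hfac, eval_mul, eval_pow, eval_X] at hi
    have hα0 : α ≠ 0 := by
      rintro rfl
      rw [orderOf_zero] at hα
      omega
    exact (mul_eq_zero.mp hi).resolve_left (pow_ne_zero _ (pow_ne_zero _ hα0))
  have hsum : ∀ (f : Fin 3 → ℕ) (j : Fin 3), ∑ i, f i = f j + f (j + 1) + f (j - 1) := by
    intro f j
    rw [Fin.sum_univ_three]
    fin_cases j
    · rfl
    · change _ = f 1 + f 2 + f 0
      omega
    · change _ = f 2 + f 0 + f 1
      omega
  rw [hsum _ j]
  omega
end

section
/- The code K3 corrects the following erasure pattern: let j0 ∈ {1,2,3} and let E_1, E_2, E_3 ⊆ {0,1,...,n-1} be sets of erased positions within the three sub-blocks such that |E_{j0}| ≤ n - k + 3s and |E_j| ≤ n - k - 2s for each j ≠ j0. If two information vectors produce K3 codewords that agree at every non-erased position (that is, for each j ∈ {1,2,3} the two sub-blocks j agree at all coordinates i ∉ E_j), then the two information vectors are equal. -/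
open Polynomial

lemma K3aux_split {F : Type*} [Field F] {A B : F[X]} {m : ℕ}
    (hA : A.degree < (m : WithBot ℕ)) (h : A + X ^ m * B = 0) : A = 0 ∧ B = 0 := by
  have hB : B = 0 := by
    by_contra hB
    have h1 : A = - (X ^ m * B) := eq_neg_of_add_eq_zero_left h
    rw [h1, degree_neg, degree_mul, degree_X_pow, degree_eq_natDegree hB] at hA
    have : m + B.natDegree < m := by exact_mod_cast hA
    omega
  subst hB
  simpa using h

lemma K3aux_deg {F : Type*} [Field F] {A B : F[X]} {m t : ℕ}
    (hA : A.degree < (m : WithBot ℕ)) (hB : B.degree < (t : WithBot ℕ)) :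
    (A + X ^ m * B).degree < ((m + t : ℕ) : WithBot ℕ) := by
  rw [degree_lt_iff_coeff_zero] at *
  intro r hr
  rw [coeff_add, hA r (by omega), coeff_X_pow_mul', if_pos (by omega), hB _ (by omega), add_zero]

lemma K3aux_add {F : Type*} [Field F] {A B : F[X]} {m : WithBot ℕ}
    (hA : A.degree < m) (hB : B.degree < m) : (A + B).degree < m :=
  lt_of_le_of_lt (degree_add_le _ _) (max_lt hA hB)

lemma K3aux_sub {F : Type*} [Field F] {A B : F[X]} {m : WithBot ℕ}
    (hA : A.degree < m) (hB : B.degree < m) : (A - B).degree < m :=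
  lt_of_le_of_lt (degree_sub_le _ _) (max_lt hA hB)

lemma K3aux_zero {F : Type*} [Field F] {n m : ℕ} {α : F} (hα : orderOf α = n)
    {p : F[X]} (hp : p.degree < (m : WithBot ℕ)) (E : Finset (Fin n))
    (hE : m + E.card ≤ n) (h : ∀ i : Fin n, i ∉ E → p.eval (α ^ (i : ℕ)) = 0) : p = 0 := by
  classical
  refine eq_zero_of_degree_lt_of_eval_index_eq_zero (s := Eᶜ) (v := fun i : Fin n => α ^ (i : ℕ))
    ?_ ?_ ?_
  · intro a _ b _ hab
    apply Fin.ext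
    exact pow_injOn_Iio_orderOf (by simp [hα]) (by simp [hα]) hab
  · refine lt_of_lt_of_le hp ?_
    rw [Finset.card_compl, Fintype.card_fin]
    exact_mod_cast (by omega : m ≤ n - E.card)
  · intro i hi
    exact h i (by simpa using hi)

/-- The linear (difference) version of the statement. -/
lemma K3aux_main (F : Type*) [Field F]
    (n k s : ℕ) (hn : 0 < n) (h4s : 4 * s < k) (hks : k + 2 * s ≤ n)
    (α : F) (hα : orderOf α = n)
    (V1 V2 V3 V4 VI : Fin 3 → F[X])
    (hV1 : ∀ j, (V1 j).degree < (s : WithBot ℕ))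
    (hV2 : ∀ j, (V2 j).degree < (s : WithBot ℕ))
    (hV3 : ∀ j, (V3 j).degree < (s : WithBot ℕ))
    (hV4 : ∀ j, (V4 j).degree < (s : WithBot ℕ))
    (hVI : ∀ j, (VI j).degree < ((k - 4 * s : ℕ) : WithBot ℕ))
    (c : Fin 3 → F[X])
    (hc : ∀ j, c j = V1 j + X ^ s * V2 j + X ^ (2 * s) * (V3 j + V4 j)
          + X ^ (3 * s) * V4 j + X ^ (4 * s) * VI j
          + X ^ k * (V2 (j - 1) + V3 (j + 1) + V4 (j + 1))
          + X ^ (k + s) * V1 (j - 1))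
    (j0 : Fin 3) (E : Fin 3 → Finset (Fin n))
    (hE0 : (E j0).card ≤ n - k + 3 * s)
    (hEj : ∀ j : Fin 3, j ≠ j0 → (E j).card ≤ n - k - 2 * s)
    (hz : ∀ j : Fin 3, ∀ i : Fin n, i ∉ E j → (c j).eval (α ^ (i : ℕ)) = 0) :
    ∀ j : Fin 3, V1 j = 0 ∧ V2 j = 0 ∧ V3 j = 0 ∧ V4 j = 0 ∧ VI j = 0 := by
  have light : ∀ j, j ≠ j0 → (V1 j = 0 ∧ V2 j = 0 ∧ V3 j = 0 ∧ V4 j = 0 ∧ VI j = 0) ∧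
      V2 (j - 1) + V3 (j + 1) + V4 (j + 1) = 0 ∧ V1 (j - 1) = 0 := by
    intro j hj
    have d34 := K3aux_add (hV3 j) (hV4 j)
    have dW := K3aux_add (K3aux_add (hV2 (j - 1)) (hV3 (j + 1))) (hV4 (j + 1))
    have heq : c j = V1 j + X ^ s * (V2 j + X ^ s * ((V3 j + V4 j) + X ^ s * (V4 j + X ^ s *
        (VI j + X ^ (k - 4 * s) * ((V2 (j - 1) + V3 (j + 1) + V4 (j + 1))
          + X ^ s * V1 (j - 1)))))) := by
      obtain ⟨d, rfl⟩ : ∃ d, k = 4 * s + d := ⟨k - 4 * s, by omega⟩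
      rw [hc j, Nat.add_sub_cancel_left]
      ring
    have dc := K3aux_deg (hV1 j) (K3aux_deg (hV2 j) (K3aux_deg d34 (K3aux_deg (hV4 j)
      (K3aux_deg (hVI j) (K3aux_deg dW (hV1 (j - 1)))))))
    rw [← heq] at dc
    have h0 := K3aux_zero hα dc (E j) (by have := hEj j hj; omega) (hz j)
    rw [heq] at h0
    obtain ⟨a1, h0⟩ := K3aux_split (hV1 j) h0
    obtain ⟨a2, h0⟩ := K3aux_split (hV2 j) h0
    obtain ⟨a3, h0⟩ := K3aux_split d34 h0
    obtain ⟨a4, h0⟩ := K3aux_split (hV4 j) h0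
    obtain ⟨a5, h0⟩ := K3aux_split (hVI j) h0
    obtain ⟨a6, h0⟩ := K3aux_split dW h0
    rw [a4, add_zero] at a3
    exact ⟨⟨a1, a2, a3, a4, a5⟩, a6, h0⟩
  have e1 : j0 + 1 ≠ j0 := by clear * -; revert j0; decide
  have e2 : j0 - 1 ≠ j0 := by clear * -; revert j0; decide
  have e3 : j0 + 1 + 1 = j0 - 1 := by clear * -; revert j0; decide
  have e4 : j0 - 1 - 1 = j0 + 1 := by clear * -; revert j0; decide
  obtain ⟨⟨p1, p2, p3, p4, p5⟩, p6, p7⟩ := light _ e1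
  obtain ⟨⟨q1, q2, q3, q4, q5⟩, q6, q7⟩ := light _ e2
  rw [e3, add_sub_cancel_right, q3, q4, add_zero, add_zero] at p6
  rw [add_sub_cancel_right] at p7
  rw [e4, sub_add_cancel, p2, zero_add] at q6
  have heq : c j0 = X ^ (3 * s) * (V4 j0 + X ^ s * VI j0) := by
    rw [hc j0, p6, p7, q6, q1, q2, p3, p4]
    ring
  have hα0 : α ≠ 0 := by
    rintro rfl
    rw [orderOf_zero] at hα
    omega
  have h0 := K3aux_zero hα (K3aux_deg (hV4 j0) (hVI j0)) (E j0) (by omega) (by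
    intro i hi
    have := hz j0 i hi
    rw [heq, eval_mul, eval_pow, eval_X] at this
    exact (mul_eq_zero.mp this).resolve_left (pow_ne_zero _ (pow_ne_zero _ hα0)))
  obtain ⟨a4, a5⟩ := K3aux_split (hV4 j0) h0
  rw [a4, add_zero] at q6
  intro j
  by_cases hj : j = j0
  · subst hj
    exact ⟨p7, p6, q6, a4, a5⟩
  · exact (light j hj).1

/-- Erasure decoding (first pattern): `K3` corrects `n - k + 3s` erasures in one sub-block
when each of the other two has at most `n - k - 2s` erasures: two codewords agreeing on all
non-erased positions come from equal information vectors. -/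
theorem K3_erasure_correction_one_heavy
    (F : Type*) [Field F] [Fintype F] [DecidableEq F]
    (n k s : ℕ) (hn : 0 < n) (hk : 0 < k) (hs : 0 < s)
    (h4s : 4 * s < k) (hks : k + 2 * s ≤ n)
    (hdvd : n ∣ Fintype.card F - 1)
    (α : F) (hα : orderOf α = n)
    -- the information vector: for each sub-unit j, polynomials V_{j,1},…,V_{j,4}
    -- of degree ≤ s-1 and V_{j,I} of degree ≤ k-4s-1
    (V1 V2 V3 V4 VI : Fin 3 → F[X])
    (hV1 : ∀ j, (V1 j).degree < (s : WithBot ℕ))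
    (hV2 : ∀ j, (V2 j).degree < (s : WithBot ℕ))
    (hV3 : ∀ j, (V3 j).degree < (s : WithBot ℕ))
    (hV4 : ∀ j, (V4 j).degree < (s : WithBot ℕ))
    (hVI : ∀ j, (VI j).degree < ((k - 4 * s : ℕ) : WithBot ℕ))
    -- the sub-block polynomials c_j (indices of sub-units taken mod 3)
    (c : Fin 3 → F[X])
    (hc : ∀ j, c j = V1 j + X ^ s * V2 j + X ^ (2 * s) * (V3 j + V4 j)
          + X ^ (3 * s) * V4 j + X ^ (4 * s) * VI j
          + X ^ k * (V2 (j - 1) + V3 (j + 1) + V4 (j + 1))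
          + X ^ (k + s) * V1 (j - 1))
    -- the sub-blocks of the codeword: evaluations of c_j at α^0, …, α^{n-1}
    (w : Fin 3 → Fin n → F)
    (hw : ∀ j (i : Fin n), w j i = (c j).eval (α ^ (i : ℕ)))
    (V1' V2' V3' V4' VI' : Fin 3 → F[X])
    (hV1' : ∀ j, (V1' j).degree < (s : WithBot ℕ))
    (hV2' : ∀ j, (V2' j).degree < (s : WithBot ℕ))
    (hV3' : ∀ j, (V3' j).degree < (s : WithBot ℕ))
    (hV4' : ∀ j, (V4' j).degree < (s : WithBot ℕ))
    (hVI' : ∀ j, (VI' j).degree < ((k - 4 * s : ℕ) : WithBot ℕ))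
    (c' : Fin 3 → F[X])
    (hc' : ∀ j, c' j = V1' j + X ^ s * V2' j + X ^ (2 * s) * (V3' j + V4' j)
          + X ^ (3 * s) * V4' j + X ^ (4 * s) * VI' j
          + X ^ k * (V2' (j - 1) + V3' (j + 1) + V4' (j + 1))
          + X ^ (k + s) * V1' (j - 1))
    (w' : Fin 3 → Fin n → F)
    (hw' : ∀ j (i : Fin n), w' j i = (c' j).eval (α ^ (i : ℕ)))
    (j0 : Fin 3) (E : Fin 3 → Finset (Fin n))
    (hE0 : (E j0).card ≤ n - k + 3 * s)
    (hEj : ∀ j : Fin 3, j ≠ j0 → (E j).card ≤ n - k - 2 * s)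
    (hagree : ∀ j : Fin 3, ∀ i : Fin n, i ∉ E j → w j i = w' j i) :
    ∀ j : Fin 3, V1 j = V1' j ∧ V2 j = V2' j ∧ V3 j = V3' j ∧ V4 j = V4' j ∧ VI j = VI' j := by
  have key := K3aux_main F n k s hn h4s hks α hα
    (fun j => V1 j - V1' j) (fun j => V2 j - V2' j) (fun j => V3 j - V3' j)
    (fun j => V4 j - V4' j) (fun j => VI j - VI' j)
    (fun j => K3aux_sub (hV1 j) (hV1' j)) (fun j => K3aux_sub (hV2 j) (hV2' j))
    (fun j => K3aux_sub (hV3 j) (hV3' j)) (fun j => K3aux_sub (hV4 j) (hV4' j))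
    (fun j => K3aux_sub (hVI j) (hVI' j)) (fun j => c j - c' j)
    (fun j => by
      simp only [hc j, hc' j]
      ring) j0 E hE0 hEj
    (fun j i hi => by
      rw [eval_sub, ← hw, ← hw', hagree j i hi, sub_self])
  simpa only [sub_eq_zero] using key
end
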